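/- Let 1/9 < α < 1 and set γ = √((9α − 1)/(3(1 − α))). Then the Lyapunov exponent of the SGB map S_{3,α} with respect to its invariant Cauchy measure has the closed form: (1/π) ∫_ℝ log( 9α(1 + x²)² / (3x² − 1)² ) · γ/(x² + γ²) dx = log( (1/α) · (3(1 − α)/8)² · (1 + γ)⁴ ). -/

import Mathlib

open Real MeasureTheory

/-- The substitution `x = γ tan (θ / 2)` turns an integral against the Cauchy kernel into a circle
average. -/
theorem integral_mul_cauchyKernel_eq_circleAverage (H : ℂ → ℝ) {γ : ℝ} (hγ : 0 < γ) :
    ∫ x : ℝ, H (circleMap 0 1 (2 * arctan (x / γ))) * (γ / (x ^ 2 + γ ^ 2)) =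
      π * circleAverage H 0 1 := by
  have himage : (fun θ => γ * tan θ) '' Set.Ioo (-(π / 2)) (π / 2) = Set.univ := by
    refine Set.eq_univ_of_forall fun x => ⟨arctan (x / γ), arctan_mem_Ioo _, ?_⟩
    simp only [tan_arctan]
    field_simp
  have hinj : Set.InjOn (fun θ => γ * tan θ) (Set.Ioo (-(π / 2)) (π / 2)) :=
    fun a ha b hb hab => injOn_tan ha hb (mul_left_cancel₀ hγ.ne' hab)
  have hsubst := integral_image_eq_integral_abs_deriv_smul measurableSet_Ioo
    (fun θ hθ => ((hasDerivAt_tan_of_mem_Ioo hθ).const_mul γ).hasDerivWithinAt) hinj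
    (fun x => H (circleMap 0 1 (2 * arctan (x / γ))) * (γ / (x ^ 2 + γ ^ 2)))
  rw [himage, setIntegral_univ] at hsubst
  rw [hsubst, setIntegral_congr_fun (g := fun θ => H (circleMap 0 1 (2 * θ))) measurableSet_Ioo,
    ← integral_Ioc_eq_integral_Ioo, ← intervalIntegral.integral_of_le (by linarith [pi_pos]),
    intervalIntegral.integral_comp_mul_left (fun θ => H (circleMap 0 1 θ)) two_ne_zero,
    circleAverage_def]
  · have hper : Function.Periodic (fun θ => H (circleMap 0 1 θ)) (2 * π) :=
      fun θ => by simp only [periodic_circleMap 0 1 θ]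
    have hshift := hper.intervalIntegral_add_eq (-π) 0
    rw [zero_add, show -π + 2 * π = π by ring] at hshift
    rw [show 2 * -(π / 2) = -π by ring, show 2 * (π / 2) = π by ring, hshift]
    simp only [smul_eq_mul]
    field_simp [pi_ne_zero]
  · intro θ hθ
    have hcos := cos_pos_of_mem_Ioo hθ
    have harctan : arctan (γ * tan θ / γ) = θ := by
      rw [mul_div_cancel_left₀ _ hγ.ne', arctan_tan hθ.1 hθ.2]
    simp only [harctan, smul_eq_mul]
    rw [abs_of_pos (by positivity), tan_eq_sin_div_cos]
    field_simp
    rw [sin_sq_add_cos_sq]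
    ring

theorem circleIntegrable_log_norm_mul_add (a b : ℂ) :
    CircleIntegrable (fun z => log ‖a * z + b‖) 0 1 :=
  MeromorphicOn.circleIntegrable_log_norm fun _ _ => by fun_prop

theorem circleAverage_log_norm_mul_add_of_norm_le {a b : ℂ} (ha : a ≠ 0) (hab : ‖b‖ ≤ ‖a‖) :
    circleAverage (fun z => log ‖a * z + b‖) 0 1 = log ‖a‖ := by
  have h := Polynomial.logMahlerMeasure_C_mul_X_add_C (a := a) (b := b) ha
  simp only [Polynomial.logMahlerMeasure_def, Polynomial.eval_add, Polynomial.eval_mul,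
    Polynomial.eval_C, Polynomial.eval_X] at h
  rw [h, (posLog_eq_zero_iff _).2, add_zero]
  have : 0 < ‖a‖ := norm_pos_iff.2 ha
  rw [norm_mul, norm_inv, abs_of_nonneg (by positivity)]
  field_simp
  exact hab

theorem norm_sq_mul_circleMap_add (p q r s t : ℝ) :
    ‖(⟨p, q⟩ : ℂ) * circleMap 0 1 (2 * t) + ⟨r, s⟩‖ ^ 2 =
      ((p + r) * cos t + (s - q) * sin t) ^ 2 + ((q + s) * cos t + (p - r) * sin t) ^ 2 := by
  have hz : circleMap 0 1 (2 * t) = (⟨cos (2 * t), sin (2 * t)⟩ : ℂ) := by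
    apply Complex.ext <;> simp [circleMap, Complex.exp_re, Complex.exp_im]
  rw [hz, ← Complex.normSq_eq_norm_sq, Complex.normSq_apply]
  simp only [Complex.add_re, Complex.mul_re, Complex.add_im, Complex.mul_im, cos_two_mul',
    sin_two_mul]
  linear_combination (((p + r) * cos t + (s - q) * sin t) ^ 2 +
    ((q + s) * cos t + (p - r) * sin t) ^ 2 -
    r * (2 * (p * (cos t ^ 2 - sin t ^ 2) - q * (2 * sin t * cos t)) +
      r * (1 + sin t ^ 2 + cos t ^ 2)) -
    s * (2 * (p * (2 * sin t * cos t) + q * (cos t ^ 2 - sin t ^ 2)) +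
      s * (1 + sin t ^ 2 + cos t ^ 2))) * sin_sq_add_cos_sq t

/-- Closed form of the Lyapunov exponent of the SGB map `S_{3,α}` with respect to its
invariant Cauchy measure, for `1/9 < α < 1`:
`(1/π) ∫ log(9α(1+x²)²/(3x²−1)²) · γ/(x²+γ²) dx = log((1/α)(3(1−α)/8)²(1+γ)⁴)`, where
`γ = √((9α−1)/(3(1−α)))`. -/
theorem sgb3_lyapunov_closed_form (α : ℝ) (h1 : 1 / 9 < α) (h2 : α < 1)
    (γ : ℝ) (hγ : γ = Real.sqrt ((9 * α - 1) / (3 * (1 - α)))) :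
    (1 / Real.pi) *
      ∫ x : ℝ, Real.log (9 * α * (1 + x ^ 2) ^ 2 / (3 * x ^ 2 - 1) ^ 2) *
        (γ / (x ^ 2 + γ ^ 2)) =
    Real.log ((1 / α) * (3 * (1 - α) / 8) ^ 2 * (1 + γ) ^ 4) := by
  have hα : 0 < 1 - α := by linarith
  have hα' : 0 < α := by linarith
  have hquot : 0 < (9 * α - 1) / (3 * (1 - α)) := div_pos (by linarith) (by linarith)
  have hγpos : 0 < γ := hγ ▸ sqrt_pos.2 hquot
  have hγsq : γ ^ 2 = (9 * α - 1) / (3 * (1 - α)) := by rw [hγ, sq_sqrt hquot.le]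
  have h3 : √3 ^ 2 = 3 := sq_sqrt (by norm_num)
  set A : ℂ → ℝ := fun z => log ‖(⟨1 + γ, 0⟩ : ℂ) * z + ⟨1 - γ, 0⟩‖ with hA
  set B : ℂ → ℝ := fun z => log ‖(⟨1, √3 * γ⟩ : ℂ) * z + ⟨1, -(√3 * γ)⟩‖ with hB
  set C : ℂ → ℝ := fun z => log ‖(⟨1, -(√3 * γ)⟩ : ℂ) * z + ⟨1, √3 * γ⟩‖ with hC
  have hAint : CircleIntegrable A 0 1 := circleIntegrable_log_norm_mul_add _ _
  have hBint : CircleIntegrable B 0 1 := circleIntegrable_log_norm_mul_add _ _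
  have hCint : CircleIntegrable C 0 1 := circleIntegrable_log_norm_mul_add _ _
  have hAavg : circleAverage A 0 1 = log (1 + γ) := by
    have hnorm (r : ℝ) : ‖(⟨r, 0⟩ : ℂ)‖ = |r| := Complex.norm_real r
    rw [hA, circleAverage_log_norm_mul_add_of_norm_le, hnorm, log_abs]
    · simp [Complex.ext_iff]; positivity
    · rw [hnorm, hnorm]
      exact abs_le_abs (by linarith) (by linarith)
  have hnorm (s : ℝ) : ‖(⟨1, s⟩ : ℂ)‖ = √(1 + s ^ 2) := by
    rw [Complex.norm_eq_sqrt_sq_add_sq]; simp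
  have hBavg : circleAverage B 0 1 = log (1 + 3 * γ ^ 2) / 2 := by
    rw [hB, circleAverage_log_norm_mul_add_of_norm_le, hnorm, log_sqrt (by positivity), mul_pow, h3]
    · simp [Complex.ext_iff]
    · rw [hnorm, hnorm, neg_sq]
  have hCavg : circleAverage C 0 1 = log (1 + 3 * γ ^ 2) / 2 := by
    rw [hC, circleAverage_log_norm_mul_add_of_norm_le, hnorm, log_sqrt (by positivity), neg_sq,
      mul_pow, h3]
    · simp [Complex.ext_iff]
    · rw [hnorm, hnorm, neg_sq]
  have hne (a : ℝ) : ∀ᵐ x : ℝ, x ≠ a := by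
    simp [ae_iff]
  have hintegrand : ∀ᵐ x : ℝ,
      log (9 * α * (1 + x ^ 2) ^ 2 / (3 * x ^ 2 - 1) ^ 2) * (γ / (x ^ 2 + γ ^ 2)) =
        (fun z => (log (9 * α) + (4 : ℝ) • A z) - ((2 : ℝ) • B z + (2 : ℝ) • C z))
          (circleMap 0 1 (2 * arctan (x / γ))) * (γ / (x ^ 2 + γ ^ 2)) := by
    filter_upwards [hne (1 / √3), hne (-(1 / √3))] with x hx hx'
    congr 1
    have hs3 : √3 ≠ 0 := by positivity
    have hx1 : 1 - √3 * x ≠ 0 := fun h => hx (by field_simp; linarith)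
    have hx2 : 1 + √3 * x ≠ 0 := fun h => hx' (by field_simp; linarith)
    have hc : 0 < cos (arctan (x / γ)) := cos_arctan_pos _
    have hsin : γ * sin (arctan (x / γ)) = x * cos (arctan (x / γ)) := by
      have := tan_mul_cos hc.ne'
      rw [tan_arctan] at this
      rw [← this]
      field_simp
    simp only [hA, hB, hC, smul_eq_mul]
    have e (y : ℝ) : log y = log (y ^ 2) / 2 := by rw [log_pow]; push_cast; ring
    rw [e ‖_‖, e ‖(⟨1, √3 * γ⟩ : ℂ) * _ + _‖, e ‖(⟨1, -(√3 * γ)⟩ : ℂ) * _ + _‖,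
      norm_sq_mul_circleMap_add, norm_sq_mul_circleMap_add, norm_sq_mul_circleMap_add]
    generalize cos (arctan (x / γ)) = c at *
    generalize sin (arctan (x / γ)) = s at *
    have eA : ((1 + γ + (1 - γ)) * c + (0 - 0) * s) ^ 2 +
        ((0 + 0) * c + (1 + γ - (1 - γ)) * s) ^ 2 = (2 * c) ^ 2 * (1 + x ^ 2) := by
      linear_combination 4 * (γ * s + x * c) * hsin
    have eB : ((1 + 1) * c + (-(√3 * γ) - √3 * γ) * s) ^ 2 +
        ((√3 * γ + -(√3 * γ)) * c + (1 - 1) * s) ^ 2 = (2 * c) ^ 2 * (1 - √3 * x) ^ 2 := by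
      have : (1 + 1) * c + (-(√3 * γ) - √3 * γ) * s = 2 * c * (1 - √3 * x) := by
        linear_combination -2 * √3 * hsin
      rw [this]; ring
    have eC : ((1 + 1) * c + (√3 * γ - -(√3 * γ)) * s) ^ 2 +
        ((-(√3 * γ) + √3 * γ) * c + (1 - 1) * s) ^ 2 = (2 * c) ^ 2 * (1 + √3 * x) ^ 2 := by
      have : (1 + 1) * c + (√3 * γ - -(√3 * γ)) * s = 2 * c * (1 + √3 * x) := by
        linear_combination 2 * √3 * hsin
      rw [this]; ring
    have hfac : 3 * x ^ 2 - 1 = -((1 - √3 * x) * (1 + √3 * x)) := by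
      linear_combination (-x ^ 2) * h3
    have hpos : 1 + x ^ 2 ≠ 0 := by positivity
    rw [eA, eB, eC, hfac, neg_sq, mul_pow (1 - √3 * x), log_div (by positivity) (by positivity),
      log_mul (x := 9 * α) (by positivity) (by positivity),
      log_mul (x := (2 * c) ^ 2) (y := 1 + x ^ 2) (by positivity) hpos,
      log_mul (x := (2 * c) ^ 2) (y := (1 - √3 * x) ^ 2) (by positivity) (by positivity),
      log_mul (x := (2 * c) ^ 2) (y := (1 + √3 * x) ^ 2) (by positivity) (by positivity),
      log_mul (x := (1 - √3 * x) ^ 2) (by positivity) (by positivity)]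
    simp only [log_pow]
    push_cast
    ring
  rw [integral_congr_ae hintegrand, integral_mul_cauchyKernel_eq_circleAverage
      (fun z => (log (9 * α) + (4 : ℝ) • A z) - ((2 : ℝ) • B z + (2 : ℝ) • C z)) hγpos,
    circleAverage_fun_sub ((circleIntegrable_const _ _ _).fun_add hAint.const_fun_smul)
      (hBint.const_fun_smul.fun_add hCint.const_fun_smul),
    circleAverage_fun_add (circleIntegrable_const _ _ _) hAint.const_fun_smul,
    circleAverage_fun_add hBint.const_fun_smul hCint.const_fun_smul,
    circleAverage_fun_smul, circleAverage_fun_smul, circleAverage_fun_smul, circleAverage_const,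
    hAavg, hBavg, hCavg, one_div, inv_mul_cancel_left₀ pi_ne_zero]
  have hval : 1 + 3 * γ ^ 2 = 8 * α / (1 - α) := by
    rw [hγsq]; field_simp; ring
  have harg : 1 / α * (3 * (1 - α) / 8) ^ 2 * (1 + γ) ^ 4 =
      9 * α * (1 + γ) ^ 4 / (1 + 3 * γ ^ 2) ^ 2 := by
    rw [hval]
    field_simp
    ring
  rw [harg, log_div (by positivity) (by positivity),
    log_mul (y := (1 + γ) ^ 4) (by positivity) (by positivity), log_pow, log_pow]
  simp only [smul_eq_mul]
  push_cast
  ring
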